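/- The n-qubit GHZ parent Hamiltonian H = (1/2)(I − ⊗_{j=1}^n X_j) + (1/2) Σ_{j=1}^{n−1} (I − Z_j Z_{j+1}) on (ℂ²)^⊗n (n ≥ 2) is Hermitian, positive semidefinite, and its kernel is the one-dimensional subspace spanned by the n-qubit GHZ state (|0⟩^⊗n + |1⟩^⊗n)/√2. -/

import Mathlib

open Matrix
open scoped ComplexOrder

noncomputable section

/-- computational basis vector |0⟩ of ℂ². -/
def e0 : Fin 2 → ℂ := ![1, 0]
/-- computational basis vector |1⟩ of ℂ². -/
def e1 : Fin 2 → ℂ := ![0, 1]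

/-- Pauli X matrix X = |0⟩⟨1| + |1⟩⟨0|. -/
def X : Matrix (Fin 2) (Fin 2) ℂ := vecMulVec e0 e1 + vecMulVec e1 e0
/-- Pauli Z matrix Z = |0⟩⟨0| − |1⟩⟨1|. -/
def Z : Matrix (Fin 2) (Fin 2) ℂ := vecMulVec e0 e0 - vecMulVec e1 e1

/-- A single-qubit operator `A` acting on the `j`-th tensor factor of `(ℂ²)^⊗n`
and the identity on the other factors. -/
def onQubit (n : ℕ) (A : Matrix (Fin 2) (Fin 2) ℂ) (j : Fin n) :
    Matrix (Fin n → Fin 2) (Fin n → Fin 2) ℂ :=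
  Matrix.of fun s t =>
    A (s j) (t j) * ∏ k ∈ Finset.univ.erase j, (1 : Matrix (Fin 2) (Fin 2) ℂ) (s k) (t k)

/-- the n-fold tensor product ⊗_{j=1}^n X_j = X⊗…⊗X. -/
def bigX (n : ℕ) : Matrix (Fin n → Fin 2) (Fin n → Fin 2) ℂ :=
  Matrix.of fun s t => ∏ j, X (s j) (t j)

/-- the n-qubit GHZ parent Hamiltonian
H = (1/2)(I − ⊗_j X_j) + (1/2) Σ_{j=1}^{n−1} (I − Z_j Z_{j+1}). -/
def ghzHam (n : ℕ) : Matrix (Fin n → Fin 2) (Fin n → Fin 2) ℂ :=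
  (1 / 2 : ℂ) • ((1 : Matrix (Fin n → Fin 2) (Fin n → Fin 2) ℂ) - bigX n) +
  (1 / 2 : ℂ) • ∑ j : Fin (n - 1),
    ((1 : Matrix (Fin n → Fin 2) (Fin n → Fin 2) ℂ) -
      onQubit n Z ⟨j.1, lt_of_lt_of_le j.2 (Nat.sub_le n 1)⟩ *
      onQubit n Z ⟨j.1 + 1, Nat.add_lt_of_lt_sub j.2⟩)

/-- the n-qubit GHZ state (|0⟩^⊗n + |1⟩^⊗n)/√2. -/
def ghzState (n : ℕ) : (Fin n → Fin 2) → ℂ :=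
  fun s => ((∏ j, e0 (s j)) + ∏ j, e1 (s j)) / (Real.sqrt 2 : ℂ)

theorem X_apply (a b : Fin 2) : X a b = if b = a + 1 then 1 else 0 := by
  fin_cases a <;> fin_cases b <;> simp [X, e0, e1]

theorem Z_apply (a b : Fin 2) :
    Z a b = if a = b then (if a = 0 then 1 else -1) else 0 := by
  fin_cases a <;> fin_cases b <;> simp [Z, e0, e1]

theorem e0_apply (a : Fin 2) : e0 a = if a = 0 then 1 else 0 := by
  fin_cases a <;> simp [e0]

theorem e1_apply (a : Fin 2) : e1 a = if a = 1 then 1 else 0 := by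
  fin_cases a <;> simp [e1]

/-- The bit string with every bit flipped. -/
def flipBits {n : ℕ} (s : Fin n → Fin 2) : Fin n → Fin 2 := fun j => s j + 1

theorem flipBits_flipBits {n : ℕ} (s : Fin n → Fin 2) : flipBits (flipBits s) = s := by
  funext j
  simp only [flipBits]
  generalize s j = a
  fin_cases a <;> rfl

theorem bigX_apply {n : ℕ} (s t : Fin n → Fin 2) :
    bigX n s t = if t = flipBits s then 1 else 0 := by
  simp only [bigX, of_apply, X_apply, Finset.prod_boole, Finset.mem_univ, forall_const,
    funext_iff, flipBits]

theorem bigX_mulVec_apply {n : ℕ} (v : (Fin n → Fin 2) → ℂ) (s : Fin n → Fin 2) :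
    (bigX n *ᵥ v) s = v (flipBits s) := by
  simp [mulVec, dotProduct, bigX_apply]

theorem bigX_isHermitian (n : ℕ) : (bigX n).IsHermitian := by
  ext s t
  have h : s = flipBits t ↔ t = flipBits s := by
    constructor <;> rintro rfl <;> rw [flipBits_flipBits]
  simp [bigX_apply, h, apply_ite]

theorem bigX_mul_self (n : ℕ) : bigX n * bigX n = 1 := by
  ext s t
  simp only [mul_apply, bigX_apply, ite_mul, one_mul, zero_mul, Finset.sum_ite_eq',
    Finset.mem_univ, if_true, flipBits_flipBits, one_apply, eq_comm (a := t)]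

/-- The eigenvalue of Pauli Z on a computational basis vector. -/
def zSign (a : Fin 2) : ℂ := if a = 0 then 1 else -1

theorem onQubit_Z (n : ℕ) (j : Fin n) :
    onQubit n Z j = diagonal fun s => zSign (s j) := by
  ext s t
  simp only [onQubit, of_apply, one_apply, Finset.prod_boole, Z_apply, diagonal_apply, zSign]
  by_cases h : s = t
  · simp [h]
  · have h' : ¬ (s j = t j ∧ ∀ k ∈ Finset.univ.erase j, s k = t k) := by
      rintro ⟨hj, hk⟩
      refine h (funext fun k => ?_)
      by_cases hkj : k = j
      · rw [hkj, hj]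
      · exact hk k (by simp [hkj])
    rw [if_neg h]
    by_cases hj : s j = t j
    · rw [if_neg fun hk => h' ⟨hj, hk⟩, mul_zero]
    · rw [if_neg hj, zero_mul]

theorem zSign_mul_zSign (a b : Fin 2) : zSign a * zSign b = if a = b then 1 else -1 := by
  fin_cases a <;> fin_cases b <;> simp [zSign]

theorem onQubit_Z_mul_onQubit_Z (n : ℕ) (i j : Fin n) :
    onQubit n Z i * onQubit n Z j = diagonal fun s => if s i = s j then 1 else -1 := by
  simp only [onQubit_Z, diagonal_mul_diagonal, zSign_mul_zSign]

theorem posSemidef_half_one_sub {m : Type*} [Fintype m] [DecidableEq m] {U : Matrix m m ℂ}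
    (hU : U.IsHermitian) (hUU : U * U = 1) : ((1 / 2 : ℂ) • (1 - U)).PosSemidef := by
  have h : (1 / 2 : ℂ) • (1 - U) = ((1 / 2 : ℂ) • (1 - U))ᴴ * ((1 / 2 : ℂ) • (1 - U)) := by
    have hc : (starRingEnd ℂ) (1 / 2) = 1 / 2 := by simp [Complex.conj_ofNat]
    simp only [conjTranspose_smul, conjTranspose_sub, conjTranspose_one, hU.eq, smul_mul_smul_comm,
      sub_mul, mul_sub, hUU, one_mul, mul_one, RCLike.star_def, hc]
    module
  rw [h]
  exact posSemidef_conjTranspose_mul_self _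

theorem mulVec_add_eq_zero_iff {m : Type*} [Fintype m] {A B : Matrix m m ℂ}
    (hA : A.PosSemidef) (hB : B.PosSemidef) (v : m → ℂ) :
    (A + B) *ᵥ v = 0 ↔ A *ᵥ v = 0 ∧ B *ᵥ v = 0 := by
  rw [← (hA.add hB).dotProduct_mulVec_zero_iff, ← hA.dotProduct_mulVec_zero_iff,
    ← hB.dotProduct_mulVec_zero_iff, add_mulVec, dotProduct_add]
  exact add_eq_zero_iff_of_nonneg (hA.dotProduct_mulVec_nonneg v) (hB.dotProduct_mulVec_nonneg v)

theorem sum_mulVec_eq_zero_iff {ι m : Type*} [Fintype m] (s : Finset ι) {B : ι → Matrix m m ℂ}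
    (hB : ∀ i ∈ s, (B i).PosSemidef) (v : m → ℂ) :
    (∑ i ∈ s, B i) *ᵥ v = 0 ↔ ∀ i ∈ s, B i *ᵥ v = 0 := by
  classical
  induction s using Finset.induction_on with
  | empty => simp
  | insert a s ha ih =>
    rw [Finset.forall_mem_insert] at hB
    rw [Finset.sum_insert ha, mulVec_add_eq_zero_iff hB.1 (posSemidef_sum s hB.2),
      ih hB.2, Finset.forall_mem_insert]

theorem half_one_sub_mulVec_eq_zero_iff {m : Type*} [Fintype m] [DecidableEq m]
    (U : Matrix m m ℂ) (v : m → ℂ) : ((1 / 2 : ℂ) • (1 - U)) *ᵥ v = 0 ↔ U *ᵥ v = v := by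
  rw [smul_mulVec, smul_eq_zero_iff_right (by norm_num), sub_mulVec, one_mulVec, sub_eq_zero,
    eq_comm]

theorem diagonal_sign_posSemidef {m : Type*} [Fintype m] [DecidableEq m]
    (p : m → Prop) [DecidablePred p] :
    ((1 / 2 : ℂ) • (1 - diagonal fun s => if p s then (1 : ℂ) else -1)).PosSemidef := by
  apply posSemidef_half_one_sub
  · rw [IsHermitian, diagonal_conjTranspose]
    congr 1
    funext s
    by_cases h : p s <;> simp [h]
  · rw [diagonal_mul_diagonal, ← diagonal_one]
    congr 1
    funext s
    by_cases h : p s <;> simp [h]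

theorem diagonal_sign_mulVec_eq_self_iff {m : Type*} [Fintype m] [DecidableEq m]
    (p : m → Prop) [DecidablePred p] (v : m → ℂ) :
    (diagonal fun s => if p s then (1 : ℂ) else -1) *ᵥ v = v ↔ ∀ s, ¬ p s → v s = 0 := by
  rw [funext_iff]
  refine forall_congr' fun s => ?_
  rw [mulVec_diagonal]
  by_cases h : p s <;> simp [h, neg_eq_self]

theorem ghzHam_posSemidef (n : ℕ) : (ghzHam n).PosSemidef := by
  rw [ghzHam, Finset.smul_sum]
  refine (posSemidef_half_one_sub (bigX_isHermitian n) (bigX_mul_self n)).add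
    (posSemidef_sum _ fun j _ => ?_)
  rw [onQubit_Z_mul_onQubit_Z]
  exact diagonal_sign_posSemidef _

theorem ghzHam_mulVec_eq_zero_iff (n : ℕ) (v : (Fin n → Fin 2) → ℂ) :
    ghzHam n *ᵥ v = 0 ↔ (∀ s, v (flipBits s) = v s) ∧
      ∀ (j : ℕ) (hj : j + 1 < n) (s : Fin n → Fin 2),
        s ⟨j, Nat.lt_of_succ_lt hj⟩ ≠ s ⟨j + 1, hj⟩ → v s = 0 := by
  simp only [ghzHam, Finset.smul_sum, onQubit_Z_mul_onQubit_Z]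
  rw [mulVec_add_eq_zero_iff (posSemidef_half_one_sub (bigX_isHermitian n) (bigX_mul_self n))
      (posSemidef_sum _ fun j _ => diagonal_sign_posSemidef _),
    sum_mulVec_eq_zero_iff _ fun j _ => diagonal_sign_posSemidef _]
  simp only [half_one_sub_mulVec_eq_zero_iff, diagonal_sign_mulVec_eq_self_iff]
  refine and_congr ?_ ⟨fun h j hj => h ⟨j, by omega⟩ (Finset.mem_univ _),
    fun h j _ => h j (by omega)⟩
  simp only [funext_iff, bigX_mulVec_apply]

theorem ghzState_apply {n : ℕ} (s : Fin n → Fin 2) :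
    ghzState n s = ((if ∀ j, s j = 0 then 1 else 0) + if ∀ j, s j = 1 then 1 else 0) /
      (Real.sqrt 2 : ℂ) := by
  simp only [ghzState, e0_apply, e1_apply, Finset.prod_boole, Finset.mem_univ, forall_const]

theorem ghzHam_mulVec_ghzState (n : ℕ) : ghzHam n *ᵥ ghzState n = 0 := by
  rw [ghzHam_mulVec_eq_zero_iff]
  refine ⟨fun s => ?_, fun j hj s hs => ?_⟩
  · have h0 : ∀ a : Fin 2, a + 1 = 0 ↔ a = 1 := by decide
    have h1 : ∀ a : Fin 2, a + 1 = 1 ↔ a = 0 := by decide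
    simp only [ghzState_apply, flipBits, h0, h1]
    rw [add_comm]
  · rw [ghzState_apply, if_neg fun h => hs (by rw [h, h]), if_neg fun h => hs (by rw [h, h])]
    simp

theorem exists_ne_succ_of_not_const {n : ℕ} (hn : 0 < n) (s : Fin n → Fin 2)
    (h : ¬ ∀ j, s j = s ⟨0, hn⟩) :
    ∃ (j : ℕ) (hj : j + 1 < n), s ⟨j, Nat.lt_of_succ_lt hj⟩ ≠ s ⟨j + 1, hj⟩ := by
  by_contra! hs
  refine h fun ⟨j, hj⟩ => ?_
  induction j with
  | zero => rfl
  | succ k ih => rw [← hs k hj, ih]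

theorem ker_ghzHam (n : ℕ) (hn : 0 < n) :
    LinearMap.ker (ghzHam n).mulVecLin = Submodule.span ℂ {ghzState n} := by
  refine le_antisymm (fun v hv => ?_) ?_
  · rw [LinearMap.mem_ker, mulVecLin_apply, ghzHam_mulVec_eq_zero_iff] at hv
    obtain ⟨hflip, hzero⟩ := hv
    have hsqrt : (Real.sqrt 2 : ℂ) ≠ 0 := by simp
    refine Submodule.mem_span_singleton.2 ⟨v (fun _ => 0) * (Real.sqrt 2 : ℂ), funext fun s => ?_⟩
    rw [Pi.smul_apply, smul_eq_mul, ghzState_apply, mul_assoc, mul_div_cancel₀ _ hsqrt]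
    by_cases hs : ∀ j, s j = s ⟨0, hn⟩
    · obtain ⟨a, rfl⟩ : ∃ a, s = fun _ => a := ⟨_, funext hs⟩
      have hne : Nonempty (Fin n) := ⟨⟨0, hn⟩⟩
      have hf := hflip fun _ => 0
      have : flipBits (fun _ : Fin n => 0) = fun _ => 1 := rfl
      rw [this] at hf
      fin_cases a <;> simp [hf]
    · obtain ⟨j, hj, hne⟩ := exists_ne_succ_of_not_const hn s hs
      rw [hzero j hj s hne, if_neg fun h => hs fun j => by rw [h, h],
        if_neg fun h => hs fun j => by rw [h, h], add_zero, mul_zero]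
  · rw [Submodule.span_singleton_le_iff_mem]
    exact ghzHam_mulVec_ghzState n

theorem ghzState_ne_zero (n : ℕ) (hn : 0 < n) : ghzState n ≠ 0 := by
  intro h
  have hne : Nonempty (Fin n) := ⟨⟨0, hn⟩⟩
  have := congrFun h fun _ => 0
  simp [ghzState_apply] at this

/-- for n ≥ 2 the n-qubit GHZ parent Hamiltonian is Hermitian,
positive semidefinite, and its kernel is the one-dimensional subspace spanned
by the n-qubit GHZ state. -/
theorem ghz_parent_hamiltonian (n : ℕ) (hn : 2 ≤ n) :
    (ghzHam n).IsHermitian ∧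
    (ghzHam n).PosSemidef ∧
    LinearMap.ker (ghzHam n).mulVecLin = Submodule.span ℂ {ghzState n} ∧
    Module.finrank ℂ (LinearMap.ker (ghzHam n).mulVecLin) = 1 := by
  have hpos : 0 < n := by omega
  refine ⟨(ghzHam_posSemidef n).isHermitian, ghzHam_posSemidef n, ker_ghzHam n hpos, ?_⟩
  rw [ker_ghzHam n hpos]
  exact finrank_span_singleton (ghzState_ne_zero n hpos)
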